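/- Let Q be a commutative ring, R = Q/I a cyclic Q-algebra, and A a Q-projective resolution of R with A_0 = Q. Then there exists an A∞-algebra structure on A, i.e., a sequence of degree −1 maps m_n : (A_{≥1}[1])^{⊗n} → A_{≥1}[1] satisfying m_1 = d^{A[1]}, the curved relation m_1 m_2 + m_2(m_1⊗1 + 1⊗m_1) = d_1^A⊗1 − 1⊗d_1^A, and the Stasheff relations Σ_{i=1}^{n} Σ_{j=0}^{n−i} m_{n−i+1}(1^{⊗j} ⊗ m_i ⊗ 1^{⊗n−i−j}) = 0 for all n ≥ 3. -/

import Mathlib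

open scoped DirectSum TensorProduct
open Function LinearMap

namespace Golod

structure Cx (Q : Type) [CommRing Q] : Type 1 where
  X : ℕ → Type
  [acg : ∀ i, AddCommGroup (X i)]
  [mod : ∀ i, Module Q (X i)]
  d : ∀ i, X (i + 1) →ₗ[Q] X i

attribute [instance] Cx.acg Cx.mod

variable {Q : Type} [CommRing Q]

/-- The positive part `A_{≥1}`, reindexed so that index `i` holds `A_{i+1}`. -/
abbrev Cx.plus (C : Cx Q) : Type := ⨁ i : ℕ, C.X (i + 1)

/-- The total module of a complex. -/
abbrev Cx.total (C : Cx Q) : Type := ⨁ i : ℕ, C.X i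

def Cx.incl (C : Cx Q) (i : ℕ) : C.X (i + 1) →ₗ[Q] C.plus :=
  DirectSum.lof Q ℕ (fun j => C.X (j + 1)) i

def Cx.inclT (C : Cx Q) (i : ℕ) : C.X i →ₗ[Q] C.total :=
  DirectSum.lof Q ℕ (fun j => C.X j) i

def Cx.IsComplex (C : Cx Q) : Prop := ∀ i, (C.d i).comp (C.d (i + 1)) = 0

def Cx.IsRes (C : Cx Q) (M : Type) [AddCommGroup M] [Module Q M]
    (ε : C.X 0 →ₗ[Q] M) : Prop :=
  C.IsComplex ∧ Surjective ε ∧ range (C.d 0) = ker ε ∧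
    ∀ i, range (C.d (i + 1)) = ker (C.d i)

def Cx.IsProjRes (C : Cx Q) (M : Type) [AddCommGroup M] [Module Q M]
    (ε : C.X 0 →ₗ[Q] M) : Prop :=
  C.IsRes M ε ∧ ∀ i, Module.Projective Q (C.X i)

/-- Minimality of a complex over a local ring with maximal ideal `𝔫`. -/
def Cx.Min (C : Cx Q) (𝔫 : Ideal Q) : Prop :=
  ∀ i x, C.d i x ∈ 𝔫 • (⊤ : Submodule Q (C.X i))

/-- The curvature term `d_1^A : A_1 → A_0 = Q`, viewed on all of `A_{≥1}`. -/
def Cx.d1 (C : Cx Q) (e0 : C.X 0 ≃ₗ[Q] Q) : ∀ i, C.X (i + 1) → Q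
  | 0, x => e0 (C.d 0 x)
  | _ + 1, _ => 0

/-- The data of a family of multilinear "higher multiplication" maps on `A_{≥1}[1]`. -/
def AAlgStr (C : Cx Q) : Type :=
  ∀ n : ℕ, MultilinearMap Q (fun _ : Fin n => C.plus) C.plus

/-- The data of a family of multilinear "higher action" maps, `mG k` corresponding to
`m_{k+1}^G : (A_{≥1}[1])^{⊗ k} ⊗ G → G`. -/
def AModStr (C : Cx Q) (G : Cx Q) : Type :=
  ∀ k : ℕ, MultilinearMap Q (fun _ : Fin k => C.plus) (G.total →ₗ[Q] G.total)

/-- The curved Stasheff relations making `(m_n)` an A∞-algebra structure on a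
`Q`-projective resolution `A` of `R = Q/I` with `A_0 = Q` (via `e0`). -/
def IsAInfAlg (C : Cx Q) (e0 : C.X 0 ≃ₗ[Q] Q) (m : AAlgStr C) : Prop :=
  -- each `m_n` has degree `-1` on `A_{≥1}[1]`
  (∀ n : ℕ, 0 < n → ∀ (a : ℕ → ℕ) (x : ∀ l, C.X (a l + 1)),
      m n (fun j : Fin n => C.incl (a j) (x j)) ∈
        Set.range (C.incl ((∑ l ∈ Finset.range n, a l) + 2 * n - 3)))
  -- `m_1 = d^{A[1]}` restricted to `A_{≥1}[1]`
  ∧ (∀ (i : ℕ) (x : C.X (i + 2)), m 1 (fun _ => C.incl (i + 1) x) = - C.incl i (C.d (i + 1) x))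
  ∧ (∀ x : C.X 1, m 1 (fun _ => C.incl 0 x) = 0)
  -- the curved relation `m₁m₂ + m₂(m₁⊗1 + 1⊗m₁) = d₁ ⊗ 1 - 1 ⊗ d₁`
  ∧ (∀ (a : ℕ → ℕ) (x : ∀ l, C.X (a l + 1)),
      m 1 (fun _ => m 2 ![C.incl (a 0) (x 0), C.incl (a 1) (x 1)])
        + m 2 ![m 1 (fun _ => C.incl (a 0) (x 0)), C.incl (a 1) (x 1)]
        + ((-1 : ℤ) ^ (a 0)) • m 2 ![C.incl (a 0) (x 0), m 1 (fun _ => C.incl (a 1) (x 1))]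
      = C.d1 e0 (a 0) (x 0) • C.incl (a 1) (x 1)
        - C.d1 e0 (a 1) (x 1) • C.incl (a 0) (x 0))
  -- the Stasheff relations for `n ≥ 3`
  ∧ (∀ n : ℕ, 3 ≤ n → ∀ (a : ℕ → ℕ) (x : ∀ l, C.X (a l + 1)),
      (∑ i ∈ Finset.Icc 1 n, ∑ j ∈ Finset.range (n - i + 1),
        ((-1 : ℤ) ^ (∑ l ∈ Finset.range j, a l)) •
          m (n - i + 1) (fun k : Fin (n - i + 1) =>
            if (k : ℕ) < j then C.incl (a k) (x k)
            else if (k : ℕ) = j then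
              m i (fun l : Fin i => C.incl (a (j + (l : ℕ))) (x (j + (l : ℕ))))
            else C.incl (a ((k : ℕ) + i - 1)) (x ((k : ℕ) + i - 1)))) = 0)

/-- The curved Stasheff relations making `(m_n^G)` an A∞ `A`-module structure on a
`Q`-projective resolution `G` of the `R`-module `M`; `mG k` is `m_{k+1}^G`. -/
def IsAInfMod (C : Cx Q) (e0 : C.X 0 ≃ₗ[Q] Q) (m : AAlgStr C) (G : Cx Q)
    (mG : AModStr C G) : Prop :=
  -- degree `-1`
  (∀ (k : ℕ) (a : ℕ → ℕ) (x : ∀ l, C.X (a l + 1)) (g : ℕ) (y : G.X g),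
      mG k (fun j : Fin k => C.incl (a j) (x j)) (G.inclT g y) ∈
        Set.range (G.inclT ((∑ l ∈ Finset.range k, a l) + 2 * k + g - 1)))
  -- `m_1^G = d^G`
  ∧ (∀ (i : ℕ) (y : G.X (i + 1)), mG 0 ![] (G.inclT (i + 1) y) = G.inclT i (G.d i y))
  ∧ (∀ y : G.X 0, mG 0 ![] (G.inclT 0 y) = 0)
  -- `m₁^G m₂^G + m₂^G(m₁ ⊗ 1 + 1 ⊗ m₁^G) = d₁^A ⊗ 1`
  ∧ (∀ (a : ℕ → ℕ) (x : ∀ l, C.X (a l + 1)) (g : ℕ) (y : G.X g),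
      mG 0 ![] (mG 1 ![C.incl (a 0) (x 0)] (G.inclT g y))
        + mG 1 ![m 1 (fun _ => C.incl (a 0) (x 0))] (G.inclT g y)
        + ((-1 : ℤ) ^ (a 0)) • mG 1 ![C.incl (a 0) (x 0)] (mG 0 ![] (G.inclT g y))
      = C.d1 e0 (a 0) (x 0) • G.inclT g y)
  -- the module Stasheff relations for `n ≥ 3`
  ∧ (∀ n : ℕ, 3 ≤ n → ∀ (a : ℕ → ℕ) (x : ∀ l, C.X (a l + 1)) (g : ℕ) (y : G.X g),
      (∑ i ∈ Finset.Icc 1 n,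
        ((∑ j ∈ Finset.range (n - i),
          ((-1 : ℤ) ^ (∑ l ∈ Finset.range j, a l)) •
            mG (n - i) (fun k : Fin (n - i) =>
              if (k : ℕ) < j then C.incl (a k) (x k)
              else if (k : ℕ) = j then
                m i (fun l : Fin i => C.incl (a (j + (l : ℕ))) (x (j + (l : ℕ))))
              else C.incl (a ((k : ℕ) + i - 1)) (x ((k : ℕ) + i - 1)))
              (G.inclT g y))
          + ((-1 : ℤ) ^ (∑ l ∈ Finset.range (n - i), a l)) •
            mG (n - i) (fun k : Fin (n - i) => C.incl (a k) (x k))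
              ((mG (i - 1) (fun l : Fin (i - 1) =>
                  C.incl (a (n - i + (l : ℕ))) (x (n - i + (l : ℕ)))))
                (G.inclT g y)))) = 0)

/-- Minimality of an A∞-algebra structure: `m_n ⊗ k = 0` for all `n ≥ 2`. -/
def AAlgStr.Min {C : Cx Q} (m : AAlgStr C) (𝔫 : Ideal Q) : Prop :=
  ∀ n, 2 ≤ n → ∀ v, m n v ∈ 𝔫 • (⊤ : Submodule Q C.plus)

/-- Minimality of an A∞-module structure: `m_n^G ⊗ k = 0` for all `n ≥ 2`. -/
def AModStr.Min {C G : Cx Q} (mG : AModStr C G) (𝔫 : Ideal Q) : Prop :=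
  ∀ k, 1 ≤ k → ∀ v y, mG k v y ∈ 𝔫 • (⊤ : Submodule Q G.total)

end Golod

namespace Golod

section Bar

variable {Q : Type} [CommRing Q] {P : Type} [AddCommGroup P] [Module Q P]

local notation "𝕋" => TensorAlgebra Q P

/-- A submodule of the tensor algebra containing `1` and stable under left multiplication by
generators is everything. -/
theorem submodule_eq_top (S : Submodule Q 𝕋) (h1 : (1 : 𝕋) ∈ S)
    (hι : ∀ (x : P) (t : 𝕋), t ∈ S → TensorAlgebra.ι Q x * t ∈ S) : S = ⊤ := by
  have key : ∀ a : 𝕋, ∀ t ∈ S, a * t ∈ S := by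
    intro a
    induction a using TensorAlgebra.induction with
    | algebraMap r => intro t ht; rw [← Algebra.smul_def]; exact S.smul_mem r ht
    | ι x => exact hι x
    | mul a b ha hb => intro t ht; rw [mul_assoc]; exact ha _ (hb _ ht)
    | add a b ha hb => intro t ht; rw [add_mul]; exact S.add_mem (ha _ ht) (hb _ ht)
  rw [eq_top_iff]
  intro a _
  simpa using key a 1 h1

theorem linearMap_ext_cons {V : Type*} [AddCommGroup V] [Module Q V] {f g : 𝕋 →ₗ[Q] V}
    (h1 : f 1 = g 1)
    (hι : ∀ (x : P) (t : 𝕋), f t = g t →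
      f (TensorAlgebra.ι Q x * t) = g (TensorAlgebra.ι Q x * t)) (t : 𝕋) : f t = g t := by
  have := submodule_eq_top (LinearMap.eqLocus f g) h1 hι
  exact (this ▸ Submodule.mem_top : t ∈ LinearMap.eqLocus f g)

section Rec

variable {V : Type*} [AddCommGroup V] [Module Q V]

/-- The action of the tensor algebra on `𝕋 × V` whose second component is prescribed on
generators by `s`. -/
def consRecAux (s : P →ₗ[Q] (𝕋 × V) →ₗ[Q] V) : 𝕋 →ₐ[Q] Module.End Q (𝕋 × V) :=
  TensorAlgebra.lift Q
    { toFun := fun x =>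
        ((LinearMap.mulLeft Q (TensorAlgebra.ι Q x)).comp (LinearMap.fst Q 𝕋 V)).prod (s x)
      map_add' := fun x y => by
        ext <;> simp [add_mul]
      map_smul' := fun c x => by
        ext <;> simp }

/-- Linear maps out of the tensor algebra defined by recursion on words. -/
def consRec (s : P →ₗ[Q] (𝕋 × V) →ₗ[Q] V) (v : V) : 𝕋 →ₗ[Q] V :=
  (LinearMap.snd Q 𝕋 V).comp
    ((LinearMap.applyₗ ((1 : 𝕋), v)).comp (consRecAux s).toLinearMap)

theorem consRec_one (s : P →ₗ[Q] (𝕋 × V) →ₗ[Q] V) (v : V) : consRec s v 1 = v := by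
  simp [consRec]

theorem consRecAux_fst (s : P →ₗ[Q] (𝕋 × V) →ₗ[Q] V) (v : V) (t : 𝕋) :
    (consRecAux s t (1, v)).1 = t := by
  refine linearMap_ext_cons
    (f := (LinearMap.fst Q 𝕋 V).comp
      ((LinearMap.applyₗ ((1 : 𝕋), v)).comp (consRecAux s).toLinearMap))
    (g := LinearMap.id) (by simp) (fun x t h => ?_) t
  simp only [LinearMap.comp_apply, AlgHom.toLinearMap_apply, map_mul, consRecAux]
  simpa [consRecAux] using congrArg (TensorAlgebra.ι Q x * ·) h

theorem consRec_ι_mul (s : P →ₗ[Q] (𝕋 × V) →ₗ[Q] V) (v : V) (x : P) (t : 𝕋) :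
    consRec s v (TensorAlgebra.ι Q x * t) = s x (t, consRec s v t) := by
  have h : (t, consRec s v t) = consRecAux s t (1, v) :=
    Prod.ext (consRecAux_fst s v t).symm rfl
  rw [h]
  simp [consRec, consRecAux]

end Rec

/-- The deconcatenation coproduct. -/
def decon : 𝕋 →ₗ[Q] 𝕋 ⊗[Q] 𝕋 :=
  consRec
    { toFun := fun x =>
        (TensorProduct.mk Q 𝕋 𝕋 1).comp
            ((LinearMap.mulLeft Q (TensorAlgebra.ι Q x)).comp (LinearMap.fst Q 𝕋 _))
          + (LinearMap.mulLeft Q (TensorAlgebra.ι Q x ⊗ₜ[Q] (1 : 𝕋))).comp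
              (LinearMap.snd Q 𝕋 _)
      map_add' := fun x y => by
        apply LinearMap.ext; intro z
        simp [add_mul, TensorProduct.add_tmul, TensorProduct.tmul_add]; abel
      map_smul' := fun c x => by
        apply LinearMap.ext; intro z
        simp [← TensorProduct.smul_tmul', smul_add] }
    (1 ⊗ₜ 1)

theorem decon_one : decon (1 : 𝕋) = 1 ⊗ₜ[Q] 1 := consRec_one _ _

theorem decon_ι_mul (x : P) (t : 𝕋) :
    decon (TensorAlgebra.ι Q x * t) =
      1 ⊗ₜ[Q] (TensorAlgebra.ι Q x * t) + (TensorAlgebra.ι Q x ⊗ₜ[Q] 1) * decon t :=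
  consRec_ι_mul _ _ _ _

/-- The sum of `f p * q` over all factorizations of a word into `p` and `q`. -/
def pre (f : 𝕋 →ₗ[Q] 𝕋) : 𝕋 →ₗ[Q] 𝕋 :=
  (LinearMap.mul' Q 𝕋).comp ((f.rTensor 𝕋).comp decon)

theorem pre_apply (f : 𝕋 →ₗ[Q] 𝕋) (t : 𝕋) :
    pre f t = LinearMap.mul' Q 𝕋 (f.rTensor 𝕋 (decon t)) := rfl

theorem pre_one (f : 𝕋 →ₗ[Q] 𝕋) : pre f 1 = f 1 := by
  simp [pre_apply, decon_one]

theorem rTensor_ι_mul {V : Type*} [AddCommGroup V] [Module Q V] (f : 𝕋 →ₗ[Q] V) (s : 𝕋)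
    (z : 𝕋 ⊗[Q] 𝕋) :
    f.rTensor 𝕋 ((s ⊗ₜ[Q] 1) * z) = (f.comp (LinearMap.mulLeft Q s)).rTensor 𝕋 z := by
  induction z with
  | zero => simp
  | tmul p q => simp
  | add a b ha hb => simp [mul_add, ha, hb]

theorem pre_ι_mul (f : 𝕋 →ₗ[Q] 𝕋) (x : P) (t : 𝕋) :
    pre f (TensorAlgebra.ι Q x * t) =
      f 1 * (TensorAlgebra.ι Q x * t)
        + pre (f.comp (LinearMap.mulLeft Q (TensorAlgebra.ι Q x))) t := by
  simp [pre_apply, decon_ι_mul, rTensor_ι_mul]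

/-- The coderivation with corestriction `f`, twisted by `τ`: on words it is the sum of all
`τ p * f q * r` over the factorizations into `p`, `q`, `r`. -/
def coder (τ : P →ₗ[Q] P) (f : 𝕋 →ₗ[Q] P) : 𝕋 →ₗ[Q] 𝕋 :=
  consRec
    { toFun := fun x =>
        (LinearMap.mulLeft Q (TensorAlgebra.ι Q (τ x))).comp (LinearMap.snd Q 𝕋 𝕋)
          + (pre ((TensorAlgebra.ι Q).comp f)).comp
            ((LinearMap.mulLeft Q (TensorAlgebra.ι Q x)).comp (LinearMap.fst Q 𝕋 𝕋))
      map_add' := fun x y => by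
        apply LinearMap.ext; intro z
        simp [add_mul]; abel
      map_smul' := fun c x => by
        apply LinearMap.ext; intro z
        simp [smul_add] }
    (TensorAlgebra.ι Q (f 1))

theorem coder_one (τ : P →ₗ[Q] P) (f : 𝕋 →ₗ[Q] P) :
    coder τ f 1 = TensorAlgebra.ι Q (f 1) := consRec_one _ _

theorem coder_ι_mul (τ : P →ₗ[Q] P) (f : 𝕋 →ₗ[Q] P) (x : P) (t : 𝕋) :
    coder τ f (TensorAlgebra.ι Q x * t) =
      TensorAlgebra.ι Q (τ x) * coder τ f t
        + pre ((TensorAlgebra.ι Q).comp f) (TensorAlgebra.ι Q x * t) :=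
  consRec_ι_mul _ _ _ _

theorem pre_add (f g : 𝕋 →ₗ[Q] 𝕋) (t : 𝕋) : pre (f + g) t = pre f t + pre g t := by
  simp [pre_apply, LinearMap.rTensor_add]

theorem coder_add (τ : P →ₗ[Q] P) (f g : 𝕋 →ₗ[Q] P) (t : 𝕋) :
    coder τ (f + g) t = coder τ f t + coder τ g t := by
  refine linearMap_ext_cons (f := coder τ (f + g)) (g := coder τ f + coder τ g) ?_ ?_ t
  · simp [coder_one]
  · intro x t h
    simp only [LinearMap.add_apply] at h ⊢
    rw [coder_ι_mul, coder_ι_mul, coder_ι_mul, h, LinearMap.comp_add, pre_add, mul_add]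
    abel

theorem coder_sub (τ : P →ₗ[Q] P) (f g : 𝕋 →ₗ[Q] P) (t : 𝕋) :
    coder τ (f - g) t = coder τ f t - coder τ g t := by
  rw [eq_sub_iff_add_eq, ← coder_add, sub_add_cancel]

/-- The sum of `(f p ⊗ 1) * decon q` over the pure tensors `p ⊗ q` of an element. -/
def postDecon (f : 𝕋 →ₗ[Q] 𝕋) : 𝕋 ⊗[Q] 𝕋 →ₗ[Q] 𝕋 ⊗[Q] 𝕋 :=
  TensorProduct.lift ((LinearMap.mul Q (𝕋 ⊗[Q] 𝕋)).compl₁₂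
    (((TensorProduct.mk Q 𝕋 𝕋).flip 1).comp f) decon)

theorem postDecon_tmul (f : 𝕋 →ₗ[Q] 𝕋) (p q : 𝕋) :
    postDecon f (p ⊗ₜ q) = (f p ⊗ₜ 1) * decon q := rfl

theorem postDecon_ι_mul (f : 𝕋 →ₗ[Q] 𝕋) (s : 𝕋) (z : 𝕋 ⊗[Q] 𝕋) :
    postDecon f ((s ⊗ₜ[Q] 1) * z) = postDecon (f.comp (LinearMap.mulLeft Q s)) z := by
  induction z with
  | zero => simp
  | tmul p q => simp [postDecon_tmul]
  | add a b ha hb => simp [mul_add, ha, hb]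

theorem pre_comp_mulLeft (f : 𝕋 →ₗ[Q] 𝕋) (x : P) :
    (pre f).comp (LinearMap.mulLeft Q (TensorAlgebra.ι Q x)) =
      (LinearMap.mulLeft Q (f 1)).comp (LinearMap.mulLeft Q (TensorAlgebra.ι Q x))
        + pre (f.comp (LinearMap.mulLeft Q (TensorAlgebra.ι Q x))) := by
  apply LinearMap.ext; intro t
  simp [pre_ι_mul]

/-- Coassociativity of deconcatenation, with the first factor evaluated. -/
theorem decon_coassoc (f : 𝕋 →ₗ[Q] 𝕋) (t : 𝕋) :
    postDecon f (decon t) = (pre f).rTensor 𝕋 (decon t) := by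
  have key := submodule_eq_top
    (⨅ f : 𝕋 →ₗ[Q] 𝕋,
      LinearMap.eqLocus ((postDecon f).comp decon) (((pre f).rTensor 𝕋).comp decon)) ?_ ?_
  · have h : t ∈ (⊤ : Submodule Q 𝕋) := Submodule.mem_top
    rw [← key, Submodule.mem_iInf] at h
    exact h f
  · rw [Submodule.mem_iInf]
    intro f
    simp [decon_one, postDecon_tmul, pre_one]
  · intro x t ht
    rw [Submodule.mem_iInf] at ht ⊢
    intro f
    have h := ht (f.comp (LinearMap.mulLeft Q (TensorAlgebra.ι Q x)))
    simp only [LinearMap.mem_eqLocus, LinearMap.comp_apply] at h ⊢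
    conv_lhs => rw [decon_ι_mul]
    conv_rhs => rw [decon_ι_mul]
    rw [map_add, map_add, postDecon_ι_mul, h, rTensor_ι_mul, pre_comp_mulLeft,
      LinearMap.rTensor_add, postDecon_tmul, LinearMap.rTensor_tmul, pre_one, decon_ι_mul, mul_add,
      LinearMap.add_apply, LinearMap.rTensor_comp, LinearMap.comp_apply]
    have e : ∀ (s : 𝕋) (z : 𝕋 ⊗[Q] 𝕋), (LinearMap.mulLeft Q s).rTensor 𝕋 z = (s ⊗ₜ 1) * z := by
      intro s z
      induction z with
      | zero => simp
      | tmul p q => simp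
      | add a b ha hb => simp [mul_add, ha, hb]
    rw [e, e]
    simp [add_assoc]

theorem decon_pre (f : 𝕋 →ₗ[Q] P) (t : 𝕋) :
    decon (pre ((TensorAlgebra.ι Q).comp f) t) =
      1 ⊗ₜ pre ((TensorAlgebra.ι Q).comp f) t
        + (pre ((TensorAlgebra.ι Q).comp f)).rTensor 𝕋 (decon t) := by
  rw [← decon_coassoc, pre_apply]
  generalize decon t = z
  induction z with
  | zero => simp
  | tmul p q => simp [decon_ι_mul, postDecon_tmul]
  | add a b ha hb =>
    simp only [map_add, ha, hb, TensorProduct.tmul_add]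
    abel

/-- The algebra endomorphism of the tensor algebra induced by a linear endomorphism. -/
def twist (τ : P →ₗ[Q] P) : 𝕋 →ₐ[Q] 𝕋 := TensorAlgebra.lift Q ((TensorAlgebra.ι Q).comp τ)

theorem twist_ι (τ : P →ₗ[Q] P) (x : P) :
    twist τ (TensorAlgebra.ι Q x) = TensorAlgebra.ι Q (τ x) := by
  simp [twist]

theorem decon_coder (τ : P →ₗ[Q] P) (f : 𝕋 →ₗ[Q] P) (hf : f 1 = 0) (t : 𝕋) :
    decon (coder τ f t) =
      (coder τ f).rTensor 𝕋 (decon t)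
        + TensorProduct.map (twist τ).toLinearMap (coder τ f) (decon t) := by
  refine linearMap_ext_cons (f := decon.comp (coder τ f))
    (g := ((coder τ f).rTensor 𝕋).comp decon
      + (TensorProduct.map (twist τ).toLinearMap (coder τ f)).comp decon) ?_ ?_ t
  · simp [coder_one, hf, decon_one]
  · intro x t h
    simp only [LinearMap.comp_apply, LinearMap.add_apply] at h ⊢
    have e1 : ∀ z : 𝕋 ⊗[Q] 𝕋, (coder τ f).rTensor 𝕋 ((TensorAlgebra.ι Q x ⊗ₜ[Q] 1) * z) =
        (TensorAlgebra.ι Q (τ x) ⊗ₜ[Q] 1) * (coder τ f).rTensor 𝕋 z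
          + (pre ((TensorAlgebra.ι Q).comp f)).rTensor 𝕋 ((TensorAlgebra.ι Q x ⊗ₜ[Q] 1) * z) := by
      intro z
      induction z with
      | zero => simp
      | tmul p q => simp [coder_ι_mul, TensorProduct.add_tmul]
      | add a b ha hb => simp only [mul_add, map_add, ha, hb]; abel
    have e2 : ∀ z : 𝕋 ⊗[Q] 𝕋,
        TensorProduct.map (twist τ).toLinearMap (coder τ f) ((TensorAlgebra.ι Q x ⊗ₜ[Q] 1) * z) =
        (TensorAlgebra.ι Q (τ x) ⊗ₜ[Q] 1)
          * TensorProduct.map (twist τ).toLinearMap (coder τ f) z := by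
      intro z
      induction z with
      | zero => simp
      | tmul p q => simp [twist_ι]
      | add a b ha hb => simp only [mul_add, map_add, ha, hb]
    rw [coder_ι_mul, map_add, decon_ι_mul, h, decon_pre]
    rw [decon_ι_mul x t, map_add, map_add, map_add, e1, e2]
    simp [coder_one, pre_one, hf, coder_ι_mul, mul_add, TensorProduct.tmul_add]
    abel

theorem coder_pre (τ : P →ₗ[Q] P) (f : 𝕋 →ₗ[Q] P) (t : 𝕋) :
    coder τ f (pre ((TensorAlgebra.ι Q).comp f) t) =
      LinearMap.mul' Q 𝕋
          (TensorProduct.map ((TensorAlgebra.ι Q).comp (τ.comp f)) (coder τ f) (decon t))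
        + pre ((TensorAlgebra.ι Q).comp f) (pre ((TensorAlgebra.ι Q).comp f) t) := by
  rw [pre_apply _ t]
  generalize decon t = z
  induction z with
  | zero => simp
  | tmul p q => simp [coder_ι_mul]
  | add a b ha hb =>
    simp only [map_add, ha, hb]
    abel

theorem coder_coder (τ : P →ₗ[Q] P) (f : 𝕋 →ₗ[Q] P) (hf : f 1 = 0) (hτ : ∀ x, τ (τ x) = x)
    (hodd : ∀ t, τ (f t) = - f (twist τ t)) (t : 𝕋) :
    coder τ f (coder τ f t) = coder LinearMap.id (f.comp (coder τ f)) t := by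
  refine linearMap_ext_cons (f := (coder τ f).comp (coder τ f))
    (g := coder LinearMap.id (f.comp (coder τ f))) ?_ ?_ t
  · simp [coder_one, hf]
  · intro x t h
    simp only [LinearMap.comp_apply] at h ⊢
    rw [coder_ι_mul LinearMap.id, ← h, coder_ι_mul, map_add, coder_ι_mul, coder_pre, hτ,
      LinearMap.id_apply, add_assoc]
    congr 1
    have e : TensorAlgebra.ι Q (τ x) * coder τ f t =
      coder τ f (TensorAlgebra.ι Q x * t)
        - pre ((TensorAlgebra.ι Q).comp f) (TensorAlgebra.ι Q x * t) := by
      rw [coder_ι_mul]; abel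
    rw [e, map_sub]
    generalize TensorAlgebra.ι Q x * t = s
    rw [pre_apply _ (coder τ f s), decon_coder τ f hf,
      pre_apply ((TensorAlgebra.ι Q).comp (f.comp (coder τ f))) s]
    generalize decon s = z
    have e2 : LinearMap.mul' Q 𝕋 (((TensorAlgebra.ι Q).comp f).rTensor 𝕋
        (TensorProduct.map (twist τ).toLinearMap (coder τ f) z)) =
        - LinearMap.mul' Q 𝕋
          (TensorProduct.map ((TensorAlgebra.ι Q).comp (τ.comp f)) (coder τ f) z) := by
      induction z with
      | zero => simp
      | tmul p q => simp [hodd]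
      | add a b ha hb => simp only [map_add, ha, hb]; abel
    have e3 : ((TensorAlgebra.ι Q).comp f).rTensor 𝕋 ((coder τ f).rTensor 𝕋 z) =
        ((TensorAlgebra.ι Q).comp (f.comp (coder τ f))).rTensor 𝕋 z := by
      rw [← LinearMap.rTensor_comp_apply]; rfl
    rw [map_add, map_add, e2, e3]
    abel

/-- The counit, extracting the constant term. -/
def counit : 𝕋 →ₗ[Q] Q := (TensorAlgebra.algebraMapInv (R := Q) (M := P)).toLinearMap

theorem counit_one : counit (1 : 𝕋) = 1 := by simp [counit]

theorem counit_ι_mul (x : P) (t : 𝕋) : counit (TensorAlgebra.ι Q x * t) = 0 := by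
  simp [counit, TensorAlgebra.algebraMapInv]

/-- The projection onto words of length one. -/
def letter : 𝕋 →ₗ[Q] P :=
  consRec
    { toFun := fun x => (counit.comp (LinearMap.fst Q 𝕋 P)).smulRight x
      map_add' := fun x y => by
        apply LinearMap.ext; intro z
        simp
      map_smul' := fun c x => by
        apply LinearMap.ext; intro z
        simp [smul_comm c] } 0

theorem letter_one : letter (1 : 𝕋) = 0 := consRec_one _ _

theorem letter_ι_mul (x : P) (t : 𝕋) : letter (TensorAlgebra.ι Q x * t) = counit t • x :=
  consRec_ι_mul _ _ _ _

theorem letter_ι (x : P) : letter (TensorAlgebra.ι Q x) = x := by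
  rw [← mul_one (TensorAlgebra.ι Q x), letter_ι_mul, counit_one, one_smul]

/-- The curvature `δ ⊗ 1 - 1 ⊗ δ` on words of length two, extended by zero. -/
def curv (δ : P →ₗ[Q] Q) : 𝕋 →ₗ[Q] P :=
  consRec
    { toFun := fun x => (δ x • letter.comp (LinearMap.fst Q 𝕋 P))
        - ((δ.comp letter).comp (LinearMap.fst Q 𝕋 P)).smulRight x
      map_add' := fun x y => by
        apply LinearMap.ext; intro z
        simp [add_smul]; abel
      map_smul' := fun c x => by
        apply LinearMap.ext; intro z
        simp [smul_comm c, smul_sub, mul_smul] } 0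

theorem curv_one (δ : P →ₗ[Q] Q) : curv δ (1 : 𝕋) = 0 := consRec_one _ _

theorem curv_ι_mul (δ : P →ₗ[Q] Q) (x : P) (t : 𝕋) :
    curv δ (TensorAlgebra.ι Q x * t) = δ x • letter t - δ (letter t) • x :=
  consRec_ι_mul _ _ _ _

theorem apply_curv (δ : P →ₗ[Q] Q) (t : 𝕋) : δ (curv δ t) = 0 := by
  refine linearMap_ext_cons (f := δ.comp (curv δ)) (g := 0) (by simp [curv_one]) ?_ t
  intro x t _
  simp [curv_ι_mul, mul_comm]

/-- The sum of `η q • p` over all factorizations of a word into `p` and `q`. -/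
def post (η : 𝕋 →ₗ[Q] Q) : 𝕋 →ₗ[Q] 𝕋 :=
  (TensorProduct.rid Q 𝕋).toLinearMap.comp ((η.lTensor 𝕋).comp decon)

theorem post_apply (η : 𝕋 →ₗ[Q] Q) (t : 𝕋) :
    post η t = TensorProduct.rid Q 𝕋 (η.lTensor 𝕋 (decon t)) := rfl

theorem post_one (η : 𝕋 →ₗ[Q] Q) : post η 1 = η 1 • (1 : 𝕋) := by
  simp [post_apply, decon_one]

theorem post_ι_mul (η : 𝕋 →ₗ[Q] Q) (x : P) (t : 𝕋) :
    post η (TensorAlgebra.ι Q x * t) =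
      η (TensorAlgebra.ι Q x * t) • 1 + TensorAlgebra.ι Q x * post η t := by
  rw [post_apply, decon_ι_mul, post_apply, map_add, map_add]
  refine congrArg₂ (· + ·) (by simp) ?_
  generalize decon t = z
  induction z with
  | zero => simp
  | tmul p q => simp
  | add a b ha hb => simp only [mul_add, map_add, ha, hb]

theorem post_counit (t : 𝕋) : post counit t = t := by
  refine linearMap_ext_cons (f := post counit) (g := LinearMap.id) ?_ ?_ t
  · simp [post_one, counit_one]
  · intro x t h
    simp only [LinearMap.id_apply] at h ⊢
    simp [post_ι_mul, counit_ι_mul, h]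

theorem counit_pre (f : 𝕋 →ₗ[Q] P) (t : 𝕋) :
    counit (pre ((TensorAlgebra.ι Q).comp f) t) = 0 := by
  rw [pre_apply]
  generalize decon t = z
  induction z with
  | zero => simp
  | tmul p q => simp [counit_ι_mul]
  | add a b ha hb => simp [ha, hb]

theorem counit_coder (τ : P →ₗ[Q] P) (f : 𝕋 →ₗ[Q] P) (t : 𝕋) : counit (coder τ f t) = 0 := by
  refine linearMap_ext_cons (f := counit.comp (coder τ f)) (g := 0) ?_ ?_ t
  · rw [LinearMap.comp_apply, coder_one, ← mul_one (TensorAlgebra.ι Q _), counit_ι_mul]; rfl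
  · intro x t _
    simp [coder_ι_mul, counit_ι_mul, counit_pre]

theorem letter_pre (f : 𝕋 →ₗ[Q] P) (t : 𝕋) :
    letter (pre ((TensorAlgebra.ι Q).comp f) t) = f t := by
  conv_rhs => rw [← post_counit t, post_apply]
  rw [pre_apply]
  generalize decon t = z
  induction z with
  | zero => simp
  | tmul p q => simp [letter_ι_mul]
  | add a b ha hb => simp [ha, hb]

theorem letter_coder (τ : P →ₗ[Q] P) (f : 𝕋 →ₗ[Q] P) (t : 𝕋) :
    letter (coder τ f t) = f t := by
  refine linearMap_ext_cons (f := letter.comp (coder τ f)) (g := f) ?_ ?_ t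
  · simp [coder_one, letter_ι]
  · intro x t _
    simp [coder_ι_mul, letter_ι_mul, letter_pre, counit_coder]

theorem pre_counit (s t : 𝕋) : pre (counit.smulRight s) t = s * t := by
  refine linearMap_ext_cons (f := pre (counit.smulRight s)) (g := LinearMap.mulLeft Q s) ?_ ?_ t
  · simp [pre_one, counit_one]
  · intro x t _
    have e : (counit.smulRight s).comp (LinearMap.mulLeft Q (TensorAlgebra.ι Q x)) = 0 := by
      apply LinearMap.ext; intro z; simp [counit_ι_mul]
    simp [pre_ι_mul, e, counit_one]
    simp [pre_apply]

theorem pre_letter (t : 𝕋) :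
    pre ((TensorAlgebra.ι Q).comp letter) t = t - counit t • 1 := by
  refine linearMap_ext_cons (f := pre ((TensorAlgebra.ι Q).comp letter))
    (g := LinearMap.id - counit.smulRight 1) ?_ ?_ t
  · simp [pre_one, counit_one, letter_one]
  · intro x t _
    have e : ((TensorAlgebra.ι Q).comp letter).comp (LinearMap.mulLeft Q (TensorAlgebra.ι Q x))
        = counit.smulRight (TensorAlgebra.ι Q x) := by
      apply LinearMap.ext; intro z; simp [letter_ι_mul]
    rw [pre_ι_mul, e, pre_counit]
    simp [letter_one, counit_ι_mul]

theorem pre_apply_letter_ι_mul (δ : P →ₗ[Q] Q) (x : P) (t : 𝕋) :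
    pre ((δ.comp letter).smulRight 1) (TensorAlgebra.ι Q x * t) = δ x • t := by
  have e : ((δ.comp letter).smulRight (1 : 𝕋)).comp (LinearMap.mulLeft Q (TensorAlgebra.ι Q x))
      = counit.smulRight (δ x • (1 : 𝕋)) := by
    apply LinearMap.ext; intro z; simp [letter_ι_mul, mul_smul]
  rw [pre_ι_mul, e, pre_counit]
  simp [letter_one]

theorem pre_curv_ι_mul (δ : P →ₗ[Q] Q) (x : P) (t : 𝕋) :
    pre ((TensorAlgebra.ι Q).comp (curv δ)) (TensorAlgebra.ι Q x * t) =
      δ x • (t - counit t • 1)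
        - TensorAlgebra.ι Q x * pre ((δ.comp letter).smulRight 1) t := by
  rw [pre_ι_mul, ← pre_letter, pre_apply, pre_apply, pre_apply]
  simp only [LinearMap.comp_apply, curv_one, map_zero, zero_mul, zero_add]
  generalize decon t = z
  induction z with
  | zero => simp
  | tmul p q => simp [curv_ι_mul, sub_mul]
  | add a b ha hb =>
    simp only [map_add, ha, hb, smul_add, mul_add]
    abel

/-- The coderivation of the curvature telescopes. -/
theorem coder_curv (δ : P →ₗ[Q] Q) (t : 𝕋) :
    coder LinearMap.id (curv δ) t =
      pre ((δ.comp letter).smulRight 1) t - post (δ.comp letter) t := by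
  refine linearMap_ext_cons (f := coder LinearMap.id (curv δ))
    (g := pre ((δ.comp letter).smulRight 1) - post (δ.comp letter)) ?_ ?_ t
  · simp [coder_one, curv_one, pre_one, post_one, letter_one]
  · intro x t h
    simp only [LinearMap.sub_apply] at h ⊢
    rw [coder_ι_mul, h, pre_curv_ι_mul, pre_apply_letter_ι_mul, post_ι_mul]
    simp only [LinearMap.id_apply, LinearMap.comp_apply, letter_ι_mul, mul_sub, smul_sub, map_smul,
      smul_smul, smul_eq_mul, mul_comm (δ x)]
    abel

theorem curv_coder (τ : P →ₗ[Q] P) (δ : P →ₗ[Q] Q) (f : 𝕋 →ₗ[Q] P) (hf : f 1 = 0)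
    (hδf : ∀ t, δ (f t) = 0) (hδτ : ∀ x, δ (τ x) = δ x) (t : 𝕋) :
    curv δ (coder τ f t) = f (coder LinearMap.id (curv δ) t) := by
  have e : ∀ s, curv δ (pre ((TensorAlgebra.ι Q).comp f) s) = - f (post (δ.comp letter) s) := by
    intro s
    rw [pre_apply, post_apply]
    generalize decon s = z
    induction z with
    | zero => simp
    | tmul p q => simp [curv_ι_mul, hδf]
    | add a b ha hb => simp only [map_add, ha, hb]; abel
  refine linearMap_ext_cons (f := (curv δ).comp (coder τ f))
    (g := f.comp (coder LinearMap.id (curv δ))) ?_ ?_ t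
  · simp [coder_one, hf, curv_one]
  · intro x t _
    simp only [LinearMap.comp_apply]
    rw [coder_ι_mul, map_add, e, curv_ι_mul, letter_coder, hδτ, hδf, coder_curv,
      pre_apply_letter_ι_mul]
    simp [sub_eq_add_neg]

/-- The Bianchi identity for the defect of the curved Stasheff relations. -/
theorem defect_coder (τ : P →ₗ[Q] P) (δ : P →ₗ[Q] Q) (f : 𝕋 →ₗ[Q] P) (hf : f 1 = 0)
    (hτ : ∀ x, τ (τ x) = x) (hodd : ∀ t, τ (f t) = - f (twist τ t))
    (hδf : ∀ t, δ (f t) = 0) (hδτ : ∀ x, δ (τ x) = δ x) (t : 𝕋) :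
    (f.comp (coder τ f) - curv δ) (coder τ f t) =
      f (coder LinearMap.id (f.comp (coder τ f) - curv δ) t) := by
  rw [coder_sub, map_sub, ← coder_coder τ f hf hτ hodd, ← curv_coder τ δ f hf hδf hδτ]
  rfl

end Bar

section Graded

variable {Q : Type} [CommRing Q]

/-- Words in homogeneous letters, with their suspended degrees. -/
inductive IsWord (C : Cx Q) : ℕ → TensorAlgebra Q C.plus → Prop
  | one : IsWord C 0 1
  | cons {d : ℕ} {t : TensorAlgebra Q C.plus} (i : ℕ) (y : C.X (i + 1)) (ht : IsWord C d t) :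
      IsWord C (d + (i + 2)) (TensorAlgebra.ι Q (C.incl i y) * t)

theorem Cx.plus_mem_of_incl {C : Cx Q} (S : Submodule Q C.plus)
    (h : ∀ i y, C.incl i y ∈ S) (x : C.plus) : x ∈ S := by
  induction x using DirectSum.induction_on with
  | zero => exact S.zero_mem
  | of i y => exact h i y
  | add a b ha hb => exact S.add_mem ha hb

theorem IsWord.mul {C : Cx Q} {a b : ℕ} {s t : TensorAlgebra Q C.plus}
    (hs : IsWord C a s) (ht : IsWord C b t) : IsWord C (a + b) (s * t) := by
  induction hs with
  | one => simpa using ht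
  | cons i y _ ih =>
    rw [mul_assoc]
    convert IsWord.cons i y ih using 1
    omega

theorem IsWord.letter {C : Cx Q} (i : ℕ) (y : C.X (i + 1)) :
    IsWord C (i + 2) (TensorAlgebra.ι Q (C.incl i y)) := by
  simpa using IsWord.cons i y IsWord.one

theorem mem_of_isWord {C : Cx Q} (S : Submodule Q (TensorAlgebra Q C.plus))
    (h : ∀ d t, IsWord C d t → t ∈ S) (t : TensorAlgebra Q C.plus) : t ∈ S := by
  have key := submodule_eq_top (Submodule.span Q {t | ∃ d, IsWord C d t})
    (Submodule.subset_span ⟨0, IsWord.one⟩) ?_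
  · have : Submodule.span Q {t | ∃ d, IsWord C d t} ≤ S :=
      Submodule.span_le.2 fun t ⟨d, ht⟩ => h d t ht
    exact this (key ▸ Submodule.mem_top)
  · intro x t ht
    induction ht using Submodule.span_induction with
    | zero => simp
    | add a b _ _ ha hb => rw [mul_add]; exact Submodule.add_mem _ ha hb
    | smul c a _ ha => rw [mul_smul_comm]; exact Submodule.smul_mem _ c ha
    | mem t ht =>
      obtain ⟨d, ht⟩ := ht
      exact C.plus_mem_of_incl ((Submodule.span Q {t | ∃ d, IsWord C d t}).comap
        ((LinearMap.mulRight Q t).comp (TensorAlgebra.ι Q)))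
        (fun i y => Submodule.subset_span ⟨_, IsWord.cons i y ht⟩) x

theorem linearMap_ext_isWord {C : Cx Q} {V : Type*} [AddCommGroup V] [Module Q V]
    {f g : TensorAlgebra Q C.plus →ₗ[Q] V} (h : ∀ d t, IsWord C d t → f t = g t)
    (t : TensorAlgebra Q C.plus) : f t = g t :=
  mem_of_isWord (LinearMap.eqLocus f g) h t

/-- The degree `d - 1` part of the tensor algebra. -/
def wordsBelow (C : Cx Q) : ℕ → Submodule Q (TensorAlgebra Q C.plus)
  | 0 => ⊥
  | d + 1 => Submodule.span Q {t | IsWord C d t}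

/-- The suspended degree `d - 1` part of `A_{≥1}[1]`. -/
def lettersBelow (C : Cx Q) : ℕ → Submodule Q C.plus
  | i + 3 => LinearMap.range (C.incl i)
  | _ => ⊥

theorem mul_mem_wordsBelow {C : Cx Q} {a b c : ℕ} {s t : TensorAlgebra Q C.plus}
    (hs : s ∈ wordsBelow C a) (ht : IsWord C b t) (h : c = a + b) : s * t ∈ wordsBelow C c := by
  subst h
  cases a with
  | zero => simp [(Submodule.mem_bot Q).1 hs]
  | succ a =>
    rw [Nat.add_right_comm]
    have : Submodule.span Q {t | IsWord C a t} ≤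
        (wordsBelow C (a + b + 1)).comap (LinearMap.mulRight Q t) :=
      Submodule.span_le.2 fun s hs => Submodule.subset_span (hs.mul ht)
    exact this hs

theorem mul_mem_wordsBelow_left {C : Cx Q} {a b c : ℕ} {s t : TensorAlgebra Q C.plus}
    (hs : IsWord C a s) (ht : t ∈ wordsBelow C b) (h : c = a + b) : s * t ∈ wordsBelow C c := by
  subst h
  cases b with
  | zero => simp [(Submodule.mem_bot Q).1 ht]
  | succ b =>
    have : Submodule.span Q {t | IsWord C b t} ≤
        (wordsBelow C (a + b + 1)).comap (LinearMap.mulLeft Q s) :=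
      Submodule.span_le.2 fun t ht => Submodule.subset_span (hs.mul ht)
    exact this ht

theorem ι_mem_wordsBelow {C : Cx Q} {d : ℕ} {x : C.plus} (hx : x ∈ lettersBelow C d) :
    TensorAlgebra.ι Q x ∈ wordsBelow C d := by
  match d, hx with
  | i + 3, ⟨y, hy⟩ =>
    subst hy
    exact Submodule.subset_span (IsWord.letter i y)
  | 0, hx | 1, hx | 2, hx => simp [(Submodule.mem_bot Q).1 hx]

/-- Maps of degree `-1` on the tensor algebra. -/
def IsGraded (C : Cx Q) (f : TensorAlgebra Q C.plus →ₗ[Q] C.plus) : Prop :=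
  ∀ d t, IsWord C d t → f t ∈ lettersBelow C d

theorem IsGraded.map_one {C : Cx Q} {f : TensorAlgebra Q C.plus →ₗ[Q] C.plus}
    (hf : IsGraded C f) : f 1 = 0 :=
  (Submodule.mem_bot Q).1 (hf 0 1 IsWord.one)

theorem pre_mem_wordsBelow {C : Cx Q} {d : ℕ} {t : TensorAlgebra Q C.plus} (ht : IsWord C d t)
    (s : ℕ) (F : TensorAlgebra Q C.plus →ₗ[Q] TensorAlgebra Q C.plus)
    (hF : ∀ a p, IsWord C a p → F p ∈ wordsBelow C (a + s)) :
    pre F t ∈ wordsBelow C (d + s) := by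
  induction ht generalizing s F with
  | one => rw [pre_one]; exact hF 0 1 IsWord.one
  | @cons d t i y ht ih =>
    rw [pre_ι_mul]
    refine Submodule.add_mem _ (mul_mem_wordsBelow (hF 0 1 IsWord.one) (IsWord.cons i y ht)
      (by omega)) ?_
    rw [add_assoc]
    refine ih _ _ fun a p hp => ?_
    rw [← add_assoc]
    exact hF _ _ (IsWord.cons i y hp)

/-- The sign automorphism `x ↦ (-1)^{|x|} x`. -/
def sgn (C : Cx Q) : C.plus →ₗ[Q] C.plus :=
  DirectSum.toModule Q ℕ C.plus fun i => ((-1 : ℤ) ^ i) • C.incl i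

theorem sgn_incl (C : Cx Q) (i : ℕ) (y : C.X (i + 1)) :
    sgn C (C.incl i y) = ((-1 : ℤ) ^ i) • C.incl i y := by
  simp [sgn, Cx.incl]

theorem sgn_sgn (C : Cx Q) (x : C.plus) : sgn C (sgn C x) = x := by
  refine C.plus_mem_of_incl (LinearMap.eqLocus ((sgn C).comp (sgn C)) LinearMap.id)
    (fun i y => ?_) x
  simp [sgn_incl, smul_smul, ← mul_pow]

theorem sgn_of_mem {C : Cx Q} {d : ℕ} {x : C.plus} (hx : x ∈ lettersBelow C d) :
    sgn C x = -(((-1 : ℤ) ^ d) • x) := by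
  match d, hx with
  | i + 3, ⟨y, hy⟩ =>
    subst hy
    rw [sgn_incl, pow_add]
    simp
  | 0, hx | 1, hx | 2, hx => simp [(Submodule.mem_bot Q).1 hx]

theorem twist_sgn {C : Cx Q} {d : ℕ} {t : TensorAlgebra Q C.plus} (ht : IsWord C d t) :
    twist (sgn C) t = ((-1 : ℤ) ^ d) • t := by
  induction ht with
  | one => simp
  | cons i y _ ih =>
    rw [map_mul, twist_ι, sgn_incl, ih, map_zsmul, smul_mul_smul_comm]
    congr 1
    ring

theorem IsGraded.sgn_apply {C : Cx Q} {f : TensorAlgebra Q C.plus →ₗ[Q] C.plus}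
    (hf : IsGraded C f) (t : TensorAlgebra Q C.plus) :
    sgn C (f t) = - f (twist (sgn C) t) := by
  refine linearMap_ext_isWord (f := (sgn C).comp f)
    (g := - f.comp (twist (sgn C)).toLinearMap) (fun d t ht => ?_) t
  simp only [LinearMap.comp_apply, LinearMap.neg_apply, AlgHom.toLinearMap_apply,
    sgn_of_mem (hf d t ht), twist_sgn ht, map_zsmul]

theorem IsGraded.coder_mem {C : Cx Q} {f : TensorAlgebra Q C.plus →ₗ[Q] C.plus}
    (hf : IsGraded C f) {d : ℕ} {t : TensorAlgebra Q C.plus} (ht : IsWord C d t) :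
    coder (sgn C) f t ∈ wordsBelow C d := by
  induction ht with
  | one => simp [coder_one, hf.map_one]
  | @cons d t i y ht ih =>
    rw [coder_ι_mul, sgn_incl]
    refine Submodule.add_mem _ ?_ (pre_mem_wordsBelow (IsWord.cons i y ht) 0 _
      fun a p hp => ι_mem_wordsBelow (hf a p hp))
    rw [map_zsmul, smul_mul_assoc]
    exact zsmul_mem (mul_mem_wordsBelow_left (IsWord.letter i y) ih (by omega)) _

theorem pre_of_vanish {C : Cx Q} {d : ℕ} {t : TensorAlgebra Q C.plus} (ht : IsWord C d t)
    (F : TensorAlgebra Q C.plus →ₗ[Q] TensorAlgebra Q C.plus)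
    (hF : ∀ a p, a < d → IsWord C a p → F p = 0) : pre F t = F t := by
  induction ht generalizing F with
  | one => rw [pre_one]
  | @cons d t i y ht ih =>
    rw [pre_ι_mul, hF 0 1 (by omega) IsWord.one, ih]
    · simp
    · intro a p ha hp
      exact hF _ _ (by omega) (IsWord.cons i y hp)

theorem coder_of_vanish {C : Cx Q} {d : ℕ} {t : TensorAlgebra Q C.plus} (ht : IsWord C d t)
    (τ : C.plus →ₗ[Q] C.plus) (f : TensorAlgebra Q C.plus →ₗ[Q] C.plus)
    (hf : ∀ a p, a < d → IsWord C a p → f p = 0) :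
    coder τ f t = TensorAlgebra.ι Q (f t) := by
  induction ht with
  | one => rw [coder_one]
  | @cons d t i y ht ih =>
    rw [coder_ι_mul, ih fun a p ha hp => hf a p (by omega) hp, hf d t (by omega) ht,
      pre_of_vanish (IsWord.cons i y ht)]
    · simp
    · intro a p ha hp
      simp [hf a p ha hp]

theorem apply_of_mem_wordsBelow {C : Cx Q} {V : Type*} [AddCommGroup V] [Module Q V] {d : ℕ}
    {S : Submodule Q V} {f : TensorAlgebra Q C.plus →ₗ[Q] V}
    (hf : ∀ k t, d = k + 1 → IsWord C k t → f t ∈ S) {z : TensorAlgebra Q C.plus}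
    (hz : z ∈ wordsBelow C d) : f z ∈ S := by
  cases d with
  | zero => simp [(Submodule.mem_bot Q).1 hz]
  | succ d =>
    have : Submodule.span Q {t | IsWord C d t} ≤ S.comap f :=
      Submodule.span_le.2 fun t ht => hf d t rfl ht
    exact this hz

theorem add_apply_coder {C : Cx Q} {f h : TensorAlgebra Q C.plus →ₗ[Q] C.plus}
    (hfh : IsGraded C (f + h)) {d : ℕ} {t : TensorAlgebra Q C.plus} (ht : IsWord C d t)
    (hh : ∀ a p, a < d → IsWord C a p → h p = 0) :
    (f + h) (coder (sgn C) (f + h) t) =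
      f (coder (sgn C) f t) + f (TensorAlgebra.ι Q (h t)) := by
  have e : h (coder (sgn C) (f + h) t) ∈ (⊥ : Submodule Q C.plus) :=
    apply_of_mem_wordsBelow (fun k p hk hp => hh k p (by omega) hp) (hfh.coder_mem ht)
  rw [LinearMap.add_apply, (Submodule.mem_bot Q).1 e, coder_add, coder_of_vanish ht _ h hh,
    map_add, add_zero]

theorem apply_coder_congr {C : Cx Q} {f g : TensorAlgebra Q C.plus →ₗ[Q] C.plus}
    (hg : IsGraded C g) {d : ℕ} {t : TensorAlgebra Q C.plus} (ht : IsWord C d t)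
    (h : ∀ a p, a ≤ d → IsWord C a p → g p = f p) :
    g (coder (sgn C) g t) = f (coder (sgn C) f t) := by
  have e : f + (g - f) = g := by abel
  have := add_apply_coder (f := f) (h := g - f) (e.symm ▸ hg) ht
    fun a p ha hp => by simp [h a p ha.le hp]
  rw [e] at this
  simpa [h d t le_rfl ht] using this

/-- The grading of the tensor algebra, as a polynomial-valued algebra map. -/
noncomputable def degPoly (C : Cx Q) :
    TensorAlgebra Q C.plus →ₐ[Q] Polynomial (TensorAlgebra Q C.plus) :=
  TensorAlgebra.lift Q (DirectSum.toModule Q ℕ _ fun i =>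
    ((Polynomial.monomial (i + 2)).restrictScalars Q).comp
      ((TensorAlgebra.ι Q).comp (C.incl i)))

theorem degPoly_of_isWord {C : Cx Q} {d : ℕ} {t : TensorAlgebra Q C.plus} (ht : IsWord C d t) :
    degPoly C t = Polynomial.monomial d t := by
  induction ht with
  | one => simp
  | @cons d t i y ht ih =>
    have e : degPoly C (TensorAlgebra.ι Q (C.incl i y)) =
        Polynomial.monomial (i + 2) (TensorAlgebra.ι Q (C.incl i y)) := by
      conv_lhs => rw [Cx.incl]
      simp [degPoly]
    rw [map_mul, e, ih, Polynomial.monomial_mul_monomial, add_comm d]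

/-- The projection of the tensor algebra onto its degree `d` part. -/
noncomputable def degPart (C : Cx Q) (d : ℕ) :
    TensorAlgebra Q C.plus →ₗ[Q] TensorAlgebra Q C.plus :=
  ((Polynomial.lcoeff (TensorAlgebra Q C.plus) d).restrictScalars Q).comp
    (degPoly C).toLinearMap

theorem degPart_of_isWord {C : Cx Q} {d : ℕ} {t : TensorAlgebra Q C.plus} (ht : IsWord C d t)
    (k : ℕ) : degPart C k t = if d = k then t else 0 := by
  simp [degPart, degPoly_of_isWord ht, Polynomial.coeff_monomial]

/-- The linear map agreeing with `f d` on words of degree `d`. -/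
noncomputable def glue (C : Cx Q) (f : ℕ → TensorAlgebra Q C.plus →ₗ[Q] C.plus) :
    TensorAlgebra Q C.plus →ₗ[Q] C.plus :=
  (Polynomial.lsum f).comp (degPoly C).toLinearMap

theorem glue_of_isWord {C : Cx Q} {d : ℕ} {t : TensorAlgebra Q C.plus} (ht : IsWord C d t)
    (f : ℕ → TensorAlgebra Q C.plus →ₗ[Q] C.plus) : glue C f t = f d t := by
  simp [glue, degPoly_of_isWord ht, Polynomial.lsum_apply, Polynomial.sum_monomial_index]

end Graded

theorem projective_tensorAlgebra (Q : Type) [CommRing Q] (P : Type) [AddCommGroup P] [Module Q P]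
    [Module.Projective Q P] : Module.Projective Q (TensorAlgebra Q P) := by
  obtain ⟨s, hs⟩ := (Module.projective_def (R := Q) (P := P)).1 inferInstance
  refine Module.Projective.of_split
    (M := TensorAlgebra Q (P →₀ Q))
    (TensorAlgebra.lift Q ((TensorAlgebra.ι Q).comp s)).toLinearMap
    (TensorAlgebra.lift Q
      ((TensorAlgebra.ι Q).comp (Finsupp.linearCombination Q _root_.id))).toLinearMap ?_
  have : (TensorAlgebra.lift Q ((TensorAlgebra.ι Q).comp (Finsupp.linearCombination Q _root_.id))).comp
      (TensorAlgebra.lift Q ((TensorAlgebra.ι Q).comp s)) = AlgHom.id Q (TensorAlgebra Q P) := by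
    apply TensorAlgebra.hom_ext
    apply LinearMap.ext
    intro x
    simpa using hs x
  exact congrArg AlgHom.toLinearMap this

section Resolution

variable {Q : Type} [CommRing Q]

/-- The differential of `A_{≥1}[1]`. -/
def shiftDiff (C : Cx Q) : C.plus →ₗ[Q] C.plus :=
  DirectSum.toModule Q ℕ C.plus fun i =>
    match i with
    | 0 => 0
    | i + 1 => -(C.incl i).comp (C.d (i + 1))

theorem shiftDiff_incl_zero (C : Cx Q) (y : C.X 1) : shiftDiff C (C.incl 0 y) = 0 := by
  simp [shiftDiff, Cx.incl]

theorem shiftDiff_incl_succ (C : Cx Q) (i : ℕ) (y : C.X (i + 2)) :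
    shiftDiff C (C.incl (i + 1) y) = - C.incl i (C.d (i + 1) y) := by
  simp [shiftDiff, Cx.incl]

theorem shiftDiff_incl_mem (C : Cx Q) (i : ℕ) (y : C.X (i + 1)) :
    shiftDiff C (C.incl i y) ∈ lettersBelow C (i + 2) := by
  cases i with
  | zero => rw [shiftDiff_incl_zero]; exact Submodule.zero_mem _
  | succ i => rw [shiftDiff_incl_succ]; exact neg_mem ⟨_, rfl⟩

theorem shiftDiff_shiftDiff {C : Cx Q} (hC : C.IsComplex) (x : C.plus) :
    shiftDiff C (shiftDiff C x) = 0 := by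
  refine C.plus_mem_of_incl (LinearMap.ker ((shiftDiff C).comp (shiftDiff C)))
    (fun i y => ?_) x
  match i with
  | 0 => simp [shiftDiff_incl_zero]
  | 1 => simp [shiftDiff_incl_zero, shiftDiff_incl_succ]
  | i + 2 =>
    have := LinearMap.congr_fun (hC (i + 1)) y
    simp only [LinearMap.comp_apply, LinearMap.zero_apply] at this
    simp [shiftDiff_incl_succ, this]

/-- The linear form `d_1^A` on `A_{≥1}`. -/
def augDiff (C : Cx Q) (e0 : C.X 0 ≃ₗ[Q] Q) : C.plus →ₗ[Q] Q :=
  DirectSum.toModule Q ℕ Q fun i =>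
    match i with
    | 0 => e0.toLinearMap.comp (C.d 0)
    | _ + 1 => 0

theorem augDiff_incl (C : Cx Q) (e0 : C.X 0 ≃ₗ[Q] Q) (i : ℕ) (y : C.X (i + 1)) :
    augDiff C e0 (C.incl i y) = C.d1 e0 i y := by
  cases i <;> simp [augDiff, Cx.incl, Cx.d1]

theorem augDiff_sgn (C : Cx Q) (e0 : C.X 0 ≃ₗ[Q] Q) (x : C.plus) :
    augDiff C e0 (sgn C x) = augDiff C e0 x := by
  refine C.plus_mem_of_incl (LinearMap.eqLocus ((augDiff C e0).comp (sgn C)) (augDiff C e0))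
    (fun i y => ?_) x
  cases i <;> simp [sgn_incl, augDiff_incl, Cx.d1]

theorem augDiff_shiftDiff {C : Cx Q} (hC : C.IsComplex) (e0 : C.X 0 ≃ₗ[Q] Q) (x : C.plus) :
    augDiff C e0 (shiftDiff C x) = 0 := by
  refine C.plus_mem_of_incl (LinearMap.ker ((augDiff C e0).comp (shiftDiff C)))
    (fun i y => ?_) x
  match i with
  | 0 => simp [shiftDiff_incl_zero]
  | 1 =>
    have := LinearMap.congr_fun (hC 0) y
    simp only [LinearMap.comp_apply, LinearMap.zero_apply] at this
    simp [shiftDiff_incl_succ, augDiff_incl, Cx.d1, this]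
  | i + 2 => simp [shiftDiff_incl_succ, augDiff_incl, Cx.d1]

/-- Partial A∞-structures: maps of degree `-1` extending the differential and satisfying the
curved Stasheff relations on words of degree less than `N`. -/
structure IsPartial (C : Cx Q) (e0 : C.X 0 ≃ₗ[Q] Q) (N : ℕ)
    (f : TensorAlgebra Q C.plus →ₗ[Q] C.plus) : Prop where
  graded : IsGraded C f
  map_ι : ∀ x, f (TensorAlgebra.ι Q x) = shiftDiff C x
  stasheff : ∀ d t, d < N → IsWord C d t → f (coder (sgn C) f t) = curv (augDiff C e0) t

variable {C : Cx Q} {e0 : C.X 0 ≃ₗ[Q] Q} {N : ℕ} {f : TensorAlgebra Q C.plus →ₗ[Q] C.plus}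

theorem augDiff_of_mem {d : ℕ} {x : C.plus} (hx : x ∈ lettersBelow C (d + 4)) :
    augDiff C e0 x = 0 := by
  obtain ⟨y, rfl⟩ := hx
  rw [augDiff_incl]; rfl

theorem IsPartial.augDiff_apply (hf : IsPartial C e0 N f) (hC : C.IsComplex)
    (t : TensorAlgebra Q C.plus) : augDiff C e0 (f t) = 0 := by
  refine linearMap_ext_isWord (f := (augDiff C e0).comp f) (g := 0) (fun d t ht => ?_) t
  have hm := hf.graded d t ht
  cases ht with
  | one => simp [hf.graded.map_one]
  | @cons d' t' i y ht' =>
    cases ht' with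
    | one => simp [hf.map_ι, augDiff_shiftDiff hC]
    | @cons d'' t'' j z ht'' =>
      rw [show d'' + (j + 2) + (i + 2) = (d'' + j + i) + 4 by omega] at hm
      exact augDiff_of_mem hm

theorem IsPartial.defect_coder (hf : IsPartial C e0 N f) (hC : C.IsComplex)
    (t : TensorAlgebra Q C.plus) :
    (f.comp (coder (sgn C) f) - curv (augDiff C e0)) (coder (sgn C) f t) =
      f (coder LinearMap.id (f.comp (coder (sgn C) f) - curv (augDiff C e0)) t) :=
  Golod.defect_coder _ _ _ hf.graded.map_one (sgn_sgn C) hf.graded.sgn_apply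
    (hf.augDiff_apply hC) (augDiff_sgn C e0) t

theorem IsPartial.shiftDiff_defect (hf : IsPartial C e0 N f) (hC : C.IsComplex)
    {t : TensorAlgebra Q C.plus} (ht : IsWord C N t) :
    shiftDiff C ((f.comp (coder (sgn C) f) - curv (augDiff C e0)) t) = 0 := by
  have hg : ∀ a p, a < N → IsWord C a p →
      (f.comp (coder (sgn C) f) - curv (augDiff C e0)) p = 0 := fun a p ha hp => by
    simp [hf.stasheff a p ha hp]
  have h := hf.defect_coder hC t
  rw [coder_of_vanish ht _ _ hg, hf.map_ι] at h
  rw [← h]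
  exact (Submodule.mem_bot Q).1 (apply_of_mem_wordsBelow (fun k p hk hp => hg k p (by omega) hp)
    (hf.graded.coder_mem ht))

theorem IsPartial.augDiff_defect (hf : IsPartial C e0 N f) (hC : C.IsComplex)
    (t : TensorAlgebra Q C.plus) :
    augDiff C e0 ((f.comp (coder (sgn C) f) - curv (augDiff C e0)) t) = 0 := by
  simp [hf.augDiff_apply hC, apply_curv]

theorem counit_of_isWord {d : ℕ} {t : TensorAlgebra Q C.plus} (ht : IsWord C d t) (hd : 0 < d) :
    counit t = 0 := by
  cases ht with
  | one => omega
  | cons i y _ => exact counit_ι_mul _ _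

theorem curv_mem {d : ℕ} {t : TensorAlgebra Q C.plus} (ht : IsWord C d t) :
    curv (augDiff C e0) t ∈ lettersBelow C (d - 1) := by
  cases ht with
  | one => rw [curv_one]; exact Submodule.zero_mem _
  | @cons d' t' i y ht' =>
    cases ht' with
    | one => rw [curv_ι_mul, letter_one]; simp
    | @cons d'' t'' j z ht'' =>
      rw [curv_ι_mul, letter_ι_mul]
      rcases Nat.eq_zero_or_pos d'' with rfl | hd
      · refine sub_mem ?_ ?_
        · rw [augDiff_incl]
          cases i with
          | zero =>
            refine Submodule.smul_mem _ _ (Submodule.smul_mem _ _ ?_)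
            rw [show 0 + (j + 2) + (0 + 2) - 1 = j + 3 by omega]
            exact ⟨z, rfl⟩
          | succ i => simp [Cx.d1]
        · rw [map_smul, augDiff_incl]
          cases j with
          | zero =>
            refine Submodule.smul_mem _ _ ?_
            rw [show 0 + (0 + 2) + (i + 2) - 1 = i + 3 by omega]
            exact ⟨y, rfl⟩
          | succ j => simp [Cx.d1]
      · simp [counit_of_isWord ht'' hd]

theorem IsPartial.defect_mem (hf : IsPartial C e0 N f) {d : ℕ} {t : TensorAlgebra Q C.plus}
    (ht : IsWord C (d + 1) t) :
    (f.comp (coder (sgn C) f) - curv (augDiff C e0)) t ∈ lettersBelow C d := by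
  refine sub_mem ?_ (curv_mem ht)
  rw [LinearMap.comp_apply]
  refine apply_of_mem_wordsBelow (fun k p hk hp => ?_) (hf.graded.coder_mem ht)
  obtain rfl : d = k := by omega
  exact hf.graded _ _ hp

theorem IsPartial.defect_letter (hf : IsPartial C e0 N f) (hC : C.IsComplex) (x : C.plus) :
    (f.comp (coder (sgn C) f) - curv (augDiff C e0)) (TensorAlgebra.ι Q x) = 0 := by
  rw [← mul_one (TensorAlgebra.ι Q x)]
  simp only [LinearMap.sub_apply, LinearMap.comp_apply, coder_ι_mul, coder_one, pre_ι_mul,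
    curv_ι_mul, letter_one, pre_one, hf.graded.map_one]
  simp [hf.map_ι, shiftDiff_shiftDiff hC]

/-- The projection of the tensor algebra onto words of degree `d` and length not one. -/
noncomputable def longPart (C : Cx Q) (d : ℕ) :
    TensorAlgebra Q C.plus →ₗ[Q] TensorAlgebra Q C.plus :=
  (degPart C d).comp (LinearMap.id - (TensorAlgebra.ι Q).comp letter)

theorem longPart_ι (d : ℕ) (x : C.plus) : longPart C d (TensorAlgebra.ι Q x) = 0 := by
  simp [longPart, letter_ι]

theorem longPart_of_isWord {d : ℕ} {t : TensorAlgebra Q C.plus} (ht : IsWord C d t) (k : ℕ) :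
    (∃ x, t = TensorAlgebra.ι Q x) ∨ longPart C k t = if d = k then t else 0 := by
  cases ht with
  | one =>
    right
    simp [longPart, letter_one, ← degPart_of_isWord IsWord.one]
  | @cons d' t' i y ht' =>
    cases ht' with
    | one => left; exact ⟨_, mul_one _⟩
    | @cons d'' t'' j z ht'' =>
      right
      simp [longPart, letter_ι_mul, counit_ι_mul,
        ← degPart_of_isWord (IsWord.cons i y (IsWord.cons j z ht''))]

theorem exists_isPartial_succ {M : Type} [AddCommGroup M] [Module Q M] {ε : C.X 0 →ₗ[Q] M}
    (hres : C.IsProjRes M ε) {e : ℕ} (hf : IsPartial C e0 (e + 4) f) :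
    ∃ g, IsPartial C e0 (e + 5) g ∧ ∀ d t, d ≠ e + 4 → IsWord C d t → g t = f t := by
  obtain ⟨⟨hC, -, -, hex⟩, hproj⟩ := hres
  have : ∀ i, Module.Projective Q (C.X i) := hproj
  have : Module.Projective Q (TensorAlgebra Q C.plus) := projective_tensorAlgebra _ _
  set g := f.comp (coder (sgn C) f) - curv (augDiff C e0) with hg
  have hcomp : ∀ y, DirectSum.component Q ℕ (fun j => C.X (j + 1)) e (C.incl e y) = y := by
    intro y
    simp [Cx.incl, DirectSum.component.lof_self]
  set G := (DirectSum.component Q ℕ (fun j => C.X (j + 1)) e).comp (g.comp (longPart C (e + 4)))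
    with hG
  have hker : ∀ t, C.d e (G t) = 0 := by
    refine linearMap_ext_isWord (f := (C.d e).comp G) (g := 0) fun d t ht => ?_
    rcases longPart_of_isWord ht (e + 4) with ⟨x, rfl⟩ | h
    · simp [hG, longPart_ι]
    · simp only [hG, LinearMap.comp_apply, h, LinearMap.zero_apply]
      split_ifs with hd
      · subst hd
        obtain ⟨y, hy⟩ : g t ∈ LinearMap.range (C.incl e) := hf.defect_mem ht
        rw [← hy, hcomp]
        cases e with
        | zero =>
          have h0 := hf.augDiff_defect hC t
          rw [← hg, ← hy, augDiff_incl] at h0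
          simpa [Cx.d1] using h0
        | succ e =>
          have h0 := hf.shiftDiff_defect hC ht
          rw [← hg, ← hy, shiftDiff_incl_succ, neg_eq_zero] at h0
          have := congrArg (DirectSum.component Q ℕ (fun j => C.X (j + 1)) e) h0
          simpa [Cx.incl, DirectSum.component.lof_self] using this
      · simp
  obtain ⟨H, hH⟩ := Module.projective_lifting_property ((C.d (e + 1)).rangeRestrict)
    (G.codRestrict (LinearMap.range (C.d (e + 1))) fun t => by rw [hex]; exact hker t)
    (C.d (e + 1)).surjective_rangeRestrict
  have hH : ∀ t, C.d (e + 1) (H t) = G t := fun t =>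
    congrArg Subtype.val (LinearMap.congr_fun hH t)
  set h := (C.incl (e + 1)).comp (H.comp (longPart C (e + 4))) with hh
  have hι : ∀ x, h (TensorAlgebra.ι Q x) = 0 := fun x => by simp [hh, longPart_ι]
  have hvan : ∀ d t, d ≠ e + 4 → IsWord C d t → h t = 0 := by
    intro d t hd ht
    rcases longPart_of_isWord ht (e + 4) with ⟨x, rfl⟩ | h1
    · exact hι x
    · simp [hh, h1, hd]
  have hgr : IsGraded C (f + h) := by
    intro d t ht
    refine add_mem (hf.graded d t ht) ?_
    by_cases hd : d = e + 4
    · subst hd; exact ⟨_, rfl⟩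
    · rw [hvan d t hd ht]; exact zero_mem _
  refine ⟨f + h, ⟨hgr, fun x => by simp [hf.map_ι, hι], fun d t hd ht => ?_⟩,
    fun d t hd ht => by simp [hvan d t hd ht]⟩
  rw [add_apply_coder hgr ht fun a p ha hp => hvan a p (by omega) hp, hf.map_ι]
  rcases Nat.lt_succ_iff_lt_or_eq.1 hd with hd | rfl
  · rw [hvan d t hd.ne ht, map_zero, add_zero, hf.stasheff d t hd ht]
  · have key : shiftDiff C (h t) = - g t := by
      rcases longPart_of_isWord ht (e + 4) with ⟨x, rfl⟩ | h1
      · rw [hι, hg, hf.defect_letter hC]; simp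
      · rw [if_pos rfl] at h1
        obtain ⟨y, hy⟩ : g t ∈ LinearMap.range (C.incl e) := hf.defect_mem ht
        simp [hh, h1, shiftDiff_incl_succ, hH, hG, ← hy, hcomp]
    rw [key, hg]
    simp

theorem isPartial_shiftDiff (hC : C.IsComplex) :
    IsPartial C e0 4 ((shiftDiff C).comp letter) := by
  have hs : ∀ d t, IsWord C d t →
      d < 4 → t = 1 ∨ ∃ i y, d = i + 2 ∧ t = TensorAlgebra.ι Q (C.incl i y) := by
    intro d t ht hd
    cases ht with
    | one => exact Or.inl rfl
    | @cons d' t' i y ht' =>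
      cases ht' with
      | one => exact Or.inr ⟨i, y, by omega, mul_one _⟩
      | cons j z _ => omega
  have hι : ∀ x, ((shiftDiff C).comp letter) (TensorAlgebra.ι Q x) = shiftDiff C x := fun x => by
    simp [letter_ι]
  have hgr : IsGraded C ((shiftDiff C).comp letter) := by
    intro d t ht
    cases ht with
    | one => simp [letter_one]
    | @cons d' t' i y ht' =>
      rw [LinearMap.comp_apply, letter_ι_mul]
      rcases Nat.eq_zero_or_pos d' with rfl | hd
      · rw [map_smul, zero_add]
        exact Submodule.smul_mem _ _ (shiftDiff_incl_mem C i y)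
      · simp [counit_of_isWord ht' hd]
  have h0 : IsPartial C e0 0 ((shiftDiff C).comp letter) := ⟨hgr, hι, fun d t hd => by omega⟩
  refine ⟨hgr, hι, fun d t hd ht => ?_⟩
  rcases hs d t ht hd with rfl | ⟨i, y, -, rfl⟩
  · rw [coder_one, hgr.map_one, curv_one]; simp
  · exact sub_eq_zero.1 (h0.defect_letter hC (C.incl i y))

theorem exists_isPartial {M : Type} [AddCommGroup M] [Module Q M] {ε : C.X 0 →ₗ[Q] M}
    (hres : C.IsProjRes M ε) : ∃ f, ∀ N, IsPartial C e0 N f := by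
  have step : ∀ (e : ℕ) (f : {f // IsPartial C e0 (e + 4) f}),
      ∃ g : {g // IsPartial C e0 (e + 1 + 4) g},
        ∀ d t, d ≠ e + 4 → IsWord C d t → g.1 t = f.1 t := fun e f => by
    obtain ⟨g, hg, h⟩ := exists_isPartial_succ hres f.2
    exact ⟨⟨g, hg⟩, h⟩
  choose next hnext using step
  let F : ∀ e : ℕ, {f // IsPartial C e0 (e + 4) f} :=
    Nat.rec ⟨_, isPartial_shiftDiff hres.1.1⟩ next
  have hF : ∀ e k d t, d ≤ e → IsWord C d t → (F (e + k)).1 t = (F e).1 t := by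
    intro e k d t hd ht
    induction k with
    | zero => rfl
    | succ k ih => rw [← ih]; exact hnext (e + k) (F (e + k)) d t (by omega) ht
  set f := glue C fun d => (F d).1 with hf
  have hfF : ∀ e d t, d ≤ e → IsWord C d t → f t = (F e).1 t := by
    intro e d t hd ht
    obtain ⟨k, rfl⟩ := Nat.exists_eq_add_of_le hd
    rw [hF d k d t le_rfl ht, hf, glue_of_isWord ht]
  have hgr : IsGraded C f := fun d t ht => by
    rw [hfF d d t le_rfl ht]
    exact (F d).2.graded d t ht
  have hι : ∀ x, f (TensorAlgebra.ι Q x) = shiftDiff C x := by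
    refine C.plus_mem_of_incl (LinearMap.eqLocus (f.comp (TensorAlgebra.ι Q)) (shiftDiff C))
      fun i y => ?_
    simp only [LinearMap.mem_eqLocus, LinearMap.comp_apply]
    rw [hfF _ _ _ le_rfl (IsWord.letter i y)]
    exact (F (i + 2)).2.map_ι _
  refine ⟨f, fun N => ⟨hgr, hι, fun d t _ ht => ?_⟩⟩
  rw [apply_coder_congr hgr ht fun a p ha hp => hfF d a p ha hp]
  exact (F d).2.stasheff d t (by omega) ht

end Resolution


section SeqWord

variable {Q : Type} [CommRing Q] {P : Type} [AddCommGroup P] [Module Q P]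

/-- The word formed by the first `n` terms of a sequence. -/
noncomputable def seqWord (Q : Type) [CommRing Q] {P : Type} [AddCommGroup P] [Module Q P] :
    (ℕ → P) → ℕ → TensorAlgebra Q P
  | _, 0 => 1
  | x, n + 1 => TensorAlgebra.ι Q (x 0) * seqWord Q (fun k => x (k + 1)) n

theorem seqWord_zero (x : ℕ → P) : seqWord Q x 0 = 1 := rfl

theorem seqWord_succ (x : ℕ → P) (n : ℕ) :
    seqWord Q x (n + 1) = TensorAlgebra.ι Q (x 0) * seqWord Q (fun k => x (k + 1)) n := rfl

theorem seqWord_eq_tprod (x : ℕ → P) (n : ℕ) :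
    TensorAlgebra.tprod Q P n (fun k : Fin n => x k) = seqWord Q x n := by
  rw [TensorAlgebra.tprod_apply]
  induction n generalizing x with
  | zero => simp [seqWord_zero]
  | succ n ih => simp [List.ofFn_succ, seqWord_succ, ← ih fun k => x (k + 1)]

theorem seqWord_congr {x y : ℕ → P} {n : ℕ} (h : ∀ k < n, x k = y k) :
    seqWord Q x n = seqWord Q y n := by
  rw [← seqWord_eq_tprod, ← seqWord_eq_tprod]
  exact congrArg _ (funext fun k => h k k.2)

theorem seqWord_add (x : ℕ → P) (p q : ℕ) :
    seqWord Q x (p + q) = seqWord Q x p * seqWord Q (fun k => x (p + k)) q := by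
  induction p generalizing x with
  | zero => simp [seqWord_zero]
  | succ p ih =>
    rw [Nat.add_right_comm, seqWord_succ, ih, seqWord_succ, mul_assoc]
    simp only [Nat.add_right_comm]

theorem seqWord_splice (x : ℕ → P) (y : P) (i j r : ℕ) :
    seqWord Q (fun k => if k < j then x k else if k = j then y else x (k + i - 1)) (j + (r + 1)) =
      seqWord Q x j * (TensorAlgebra.ι Q y * seqWord Q (fun k => x (j + (i + k))) r) := by
  rw [seqWord_add, seqWord_succ]
  congr 1
  · exact seqWord_congr fun k hk => if_pos hk
  · congr 1
    · simp
    · refine seqWord_congr fun k _ => ?_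
      rw [if_neg (by omega), if_neg (by omega)]
      congr 1
      omega

theorem pre_seqWord (F : TensorAlgebra Q P →ₗ[Q] TensorAlgebra Q P) (x : ℕ → P) (n : ℕ) :
    pre F (seqWord Q x n) =
      ∑ i ∈ Finset.range (n + 1), F (seqWord Q x i) * seqWord Q (fun k => x (i + k)) (n - i) := by
  induction n generalizing x F with
  | zero => simp [seqWord_zero, pre_one]
  | succ n ih =>
    rw [seqWord_succ, pre_ι_mul, ih, Finset.sum_range_succ' _ (n + 1), add_comm]
    congr 1
    · refine Finset.sum_congr rfl fun i _ => ?_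
      simp [seqWord_succ, Nat.add_right_comm]
    · simp [seqWord_zero, seqWord_succ]

theorem coder_seqWord (τ : P →ₗ[Q] P) (f : TensorAlgebra Q P →ₗ[Q] P) (hf : f 1 = 0)
    (x : ℕ → P) (n : ℕ) :
    coder τ f (seqWord Q x n) =
      ∑ j ∈ Finset.range n, seqWord Q (fun k => τ (x k)) j *
        pre ((TensorAlgebra.ι Q).comp f) (seqWord Q (fun k => x (j + k)) (n - j)) := by
  induction n generalizing x with
  | zero => simp [seqWord_zero, coder_one, hf]
  | succ n ih =>
    rw [seqWord_succ, coder_ι_mul, ih, Finset.sum_range_succ', Finset.mul_sum]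
    congr 1
    · refine Finset.sum_congr rfl fun j _ => ?_
      simp [seqWord_succ, Nat.add_right_comm, mul_assoc]
    · simp [seqWord_zero, seqWord_succ]

theorem coder_seqWord_eq_sum (τ : P →ₗ[Q] P) (f : TensorAlgebra Q P →ₗ[Q] P) (hf : f 1 = 0)
    (x : ℕ → P) (n : ℕ) :
    coder τ f (seqWord Q x n) =
      ∑ i ∈ Finset.Icc 1 n, ∑ j ∈ Finset.range (n - i + 1), seqWord Q (fun k => τ (x k)) j *
        (TensorAlgebra.ι Q (f (seqWord Q (fun k => x (j + k)) i)) *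
          seqWord Q (fun k => x (j + (i + k))) (n - i - j)) := by
  rw [coder_seqWord τ f hf, Finset.sum_comm' (t' := Finset.range n)
    (s' := fun j => Finset.Icc 1 (n - j))
    (by intro i j; simp only [Finset.mem_Icc, Finset.mem_range]; omega)]
  refine Finset.sum_congr rfl fun j _ => ?_
  rw [pre_seqWord, Finset.sum_range_succ', seqWord_zero, LinearMap.comp_apply, hf, map_zero,
    zero_mul, add_zero, Finset.mul_sum, Finset.range_eq_Ico, Finset.sum_Ico_add' (fun i =>
      seqWord Q (fun k => τ (x k)) j * (((TensorAlgebra.ι Q).comp f)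
        (seqWord Q (fun k => x (j + k)) i) * seqWord Q (fun k => x (j + (i + k))) (n - j - i))),
    zero_add]
  refine Finset.sum_congr rfl fun i _ => ?_
  rw [Nat.sub_right_comm]
  rfl

theorem coder_ι_mul_ι (τ : P →ₗ[Q] P) (f : TensorAlgebra Q P →ₗ[Q] P) (hf : f 1 = 0) (x y : P) :
    coder τ f (TensorAlgebra.ι Q x * TensorAlgebra.ι Q y) =
      TensorAlgebra.ι Q (τ x) * TensorAlgebra.ι Q (f (TensorAlgebra.ι Q y))
        + (TensorAlgebra.ι Q (f (TensorAlgebra.ι Q x)) * TensorAlgebra.ι Q y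
          + TensorAlgebra.ι Q (f (TensorAlgebra.ι Q x * TensorAlgebra.ι Q y))) := by
  rw [← mul_one (TensorAlgebra.ι Q y)]
  simp only [coder_ι_mul, coder_one, pre_ι_mul, pre_one, LinearMap.comp_apply, hf, map_zero]
  simp

theorem curv_seqWord (δ : P →ₗ[Q] Q) (x : ℕ → P) {n : ℕ} (hn : 3 ≤ n) :
    curv δ (seqWord Q x n) = 0 := by
  obtain ⟨n, rfl⟩ := Nat.exists_eq_add_of_le' hn
  simp [seqWord_succ, curv_ι_mul, letter_ι_mul, counit_ι_mul]

end SeqWord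

section Structure

variable {Q : Type} [CommRing Q] {C : Cx Q} {e0 : C.X 0 ≃ₗ[Q] Q}

theorem isWord_seqWord (a : ℕ → ℕ) (x : ∀ l, C.X (a l + 1)) (n : ℕ) :
    IsWord C ((∑ l ∈ Finset.range n, a l) + 2 * n)
      (seqWord Q (fun k => C.incl (a k) (x k)) n) := by
  induction n generalizing a with
  | zero => exact IsWord.one
  | succ n ih =>
    rw [seqWord_succ]
    convert IsWord.cons (a 0) (x 0) (ih (fun k => a (k + 1)) fun k => x (k + 1)) using 1
    rw [Finset.sum_range_succ']
    ring

theorem seqWord_sgn (a : ℕ → ℕ) (x : ∀ l, C.X (a l + 1)) (n : ℕ) :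
    seqWord Q (fun k => sgn C (C.incl (a k) (x k))) n =
      ((-1 : ℤ) ^ (∑ l ∈ Finset.range n, a l)) • seqWord Q (fun k => C.incl (a k) (x k)) n := by
  induction n generalizing a with
  | zero => simp [seqWord_zero]
  | succ n ih =>
    rw [seqWord_succ, ih (fun k => a (k + 1)) fun k => x (k + 1), sgn_incl, map_zsmul,
      smul_mul_smul_comm, seqWord_succ, Finset.sum_range_succ', ← pow_add, add_comm (a 0)]

theorem mem_range_of_mem_lettersBelow {d : ℕ} {x : C.plus} (hx : x ∈ lettersBelow C d) :
    x ∈ Set.range (C.incl (d - 3)) := by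
  match d, hx with
  | i + 3, hx => exact hx
  | 0, hx | 1, hx | 2, hx =>
    rw [(Submodule.mem_bot Q).1 hx]
    exact ⟨0, map_zero _⟩

/-- The multilinear components of a linear map on the tensor algebra. -/
noncomputable def components (f : TensorAlgebra Q C.plus →ₗ[Q] C.plus) : AAlgStr C :=
  fun n => f.compMultilinearMap (TensorAlgebra.tprod Q C.plus n)

theorem components_apply (f : TensorAlgebra Q C.plus →ₗ[Q] C.plus) (x : ℕ → C.plus) (n : ℕ) :
    components f n (fun k : Fin n => x k) = f (seqWord Q x n) :=
  congrArg f (seqWord_eq_tprod x n)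

theorem components_one (f : TensorAlgebra Q C.plus →ₗ[Q] C.plus) (x : C.plus) :
    components f 1 (fun _ => x) = f (TensorAlgebra.ι Q x) := by
  simp [components, TensorAlgebra.tprod_apply]

theorem components_two (f : TensorAlgebra Q C.plus →ₗ[Q] C.plus) (x y : C.plus) :
    components f 2 ![x, y] = f (TensorAlgebra.ι Q x * TensorAlgebra.ι Q y) := by
  simp [components, TensorAlgebra.tprod_apply, List.ofFn_succ]

theorem isAInfAlg_components {f : TensorAlgebra Q C.plus →ₗ[Q] C.plus}
    (hf : ∀ N, IsPartial C e0 N f) : IsAInfAlg C e0 (components f) := by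
  have h1 : f 1 = 0 := (hf 0).graded.map_one
  have hst : ∀ n (a : ℕ → ℕ) (x : ∀ l, C.X (a l + 1)),
      f (coder (sgn C) f (seqWord Q (fun k => C.incl (a k) (x k)) n)) =
        curv (augDiff C e0) (seqWord Q (fun k => C.incl (a k) (x k)) n) := fun n a x =>
    (hf _).stasheff _ _ (Nat.lt_succ_self _) (isWord_seqWord a x n)
  refine ⟨fun n _ a x => ?_, fun i x => ?_, fun x => ?_, fun a x => ?_, fun n hn a x => ?_⟩
  · rw [components_apply f fun k => C.incl (a k) (x k)]
    exact mem_range_of_mem_lettersBelow ((hf 0).graded _ _ (isWord_seqWord a x n))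
  · rw [components_one, (hf 0).map_ι, shiftDiff_incl_succ]
  · rw [components_one, (hf 0).map_ι, shiftDiff_incl_zero]
  · have h := (hf _).stasheff _ _ (Nat.lt_succ_self _)
      ((IsWord.letter (a 0) (x 0)).mul (IsWord.letter (a 1) (x 1)))
    rw [coder_ι_mul_ι _ _ h1, curv_ι_mul, letter_ι, sgn_incl, map_zsmul, smul_mul_assoc,
      map_add, map_add, map_zsmul, augDiff_incl, augDiff_incl] at h
    simp only [components_one, components_two]
    rw [← h]
    abel
  · rw [← curv_seqWord (augDiff C e0) (fun k => C.incl (a k) (x k)) hn, ← hst,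
      coder_seqWord_eq_sum _ _ h1, map_sum]
    refine Finset.sum_congr rfl fun i hi => ?_
    rw [map_sum]
    refine Finset.sum_congr rfl fun j hj => ?_
    rw [Finset.mem_Icc] at hi
    rw [Finset.mem_range] at hj
    rw [components_apply f (fun l => C.incl (a (j + l)) (x (j + l)))]
    rw [components_apply f (fun k => if k < j then C.incl (a k) (x k)
      else if k = j then f (seqWord Q (fun l => C.incl (a (j + l)) (x (j + l))) i)
      else C.incl (a (k + i - 1)) (x (k + i - 1)))]
    rw [show n - i + 1 = j + (n - i - j + 1) by omega,
      seqWord_splice (fun k => C.incl (a k) (x k)), seqWord_sgn, smul_mul_assoc, map_zsmul]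

end Structure

/-- Every `Q`-projective resolution `A` of `R = Q/I` with `A_0 = Q`
carries an A∞-algebra structure. -/
theorem exists_aInfAlg (Q : Type) [CommRing Q] (I : Ideal Q)
    (C : Cx Q) (e0 : C.X 0 ≃ₗ[Q] Q) (ε : C.X 0 →ₗ[Q] Q ⧸ I)
    (hcompat : ∀ x, ε x = Ideal.Quotient.mk I (e0 x))
    (hres : C.IsProjRes (Q ⧸ I) ε) :
    ∃ m : AAlgStr C, IsAInfAlg C e0 m := by
  obtain ⟨f, hf⟩ := exists_isPartial (e0 := e0) hres
  exact ⟨components f, isAInfAlg_components hf⟩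

end Golod
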